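/- Let 0 < m < 2, m ≠ 1, let g : ℕ → ℝ be positive, and let x, y : ℕ → ℝ satisfy x(0) > 0, y(0) > 0, x(t+1) = x(t) · (g(t) / x(t))^m, y(t+1) = y(t) · (g(t) / y(t))^m. Then for every t, |ln(x(t+1) / y(t+1))| = |1 − m| · |ln(x(t) / y(t))|; in particular, whenever x(t) ≠ y(t) the fairness gap |ln(x(t)/y(t))| strictly decreases in one round. -/

import Mathlib

/-- The rate recursion `x (t + 1) = x t * (g t / x t) ^ m` with positive targets preserves
positivity. -/
theorem pos_of_rate_recursion {m : ℝ} {g x : ℕ → ℝ} (hg : ∀ t, 0 < g t) (hx0 : 0 < x 0)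
    (hx : ∀ t, x (t + 1) = x t * (g t / x t) ^ m) (t : ℕ) : 0 < x t := by
  induction t with
  | zero => exact hx0
  | succ t ih =>
    rw [hx]
    exact mul_pos ih (Real.rpow_pos_of_pos (div_pos (hg t) ih) m)

/-- One multiplicative update towards `c` is an affine map in logarithmic scale. -/
theorem log_mul_div_rpow {a c : ℝ} (m : ℝ) (ha : 0 < a) (hc : 0 < c) :
    Real.log (a * (c / a) ^ m) = (1 - m) * Real.log a + m * Real.log c := by
  have hca : 0 < c / a := div_pos hc ha
  rw [Real.log_mul ha.ne' (Real.rpow_pos_of_pos hca m).ne', Real.log_rpow hca,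
    Real.log_div hc.ne' ha.ne']
  ring

/-- Let `0 < m < 2`, `m ≠ 1`, let `g : ℕ → ℝ` be positive, and let
`x, y : ℕ → ℝ` satisfy `x 0 > 0`, `y 0 > 0`,
`x (t+1) = x t * (g t / x t) ^ m`, `y (t+1) = y t * (g t / y t) ^ m`
(real powers). Then for every `t`,
`|ln (x (t+1) / y (t+1))| = |1 − m| * |ln (x t / y t)|`; in particular,
whenever `x t ≠ y t` the fairness gap `|ln (x t / y t)|` strictly decreases
in one round. -/
theorem stmt_9 (m : ℝ) (hm0 : 0 < m) (hm2 : m < 2) (hm1 : m ≠ 1)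
    (g x y : ℕ → ℝ) (hg : ∀ t, 0 < g t) (hx0 : 0 < x 0) (hy0 : 0 < y 0)
    (hx : ∀ t, x (t + 1) = x t * (g t / x t) ^ m)
    (hy : ∀ t, y (t + 1) = y t * (g t / y t) ^ m) :
    ∀ t, |Real.log (x (t + 1) / y (t + 1))| = |1 - m| * |Real.log (x t / y t)| ∧
      (x t ≠ y t →
        |Real.log (x (t + 1) / y (t + 1))| < |Real.log (x t / y t)|) := by
  intro t
  have hxp := pos_of_rate_recursion hg hx0 hx
  have hyp := pos_of_rate_recursion hg hy0 hy
  have key : |Real.log (x (t + 1) / y (t + 1))| = |1 - m| * |Real.log (x t / y t)| := by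
    rw [Real.log_div (hxp _).ne' (hyp _).ne', Real.log_div (hxp _).ne' (hyp _).ne', hx, hy,
      log_mul_div_rpow m (hxp t) (hg t), log_mul_div_rpow m (hyp t) (hg t), ← abs_mul]
    congr 1
    ring
  refine ⟨key, fun hne => ?_⟩
  rw [key]
  have hlog : Real.log (x t / y t) ≠ 0 :=
    Real.log_ne_zero_of_pos_of_ne_one (div_pos (hxp t) (hyp t))
      fun h => hne ((div_eq_one_iff_eq (hyp t).ne').mp h)
  exact mul_lt_of_lt_one_left (abs_pos.mpr hlog)
    (abs_lt.mpr ⟨by linarith, by linarith⟩)
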